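/- The exclusive-stack (key confidentiality) finite state machine of VRASED satisfies LTL Specifications (5) and (6). Precisely: let V(in) := (¬(PC ∈ CR) ∧ (R_en ∨ W_en) ∧ (D_addr ∈ XS)) ∨ ((PC ∈ CR) ∧ W_en ∧ ¬(D_addr ∈ XS) ∧ ¬(D_addr ∈ MR)), and let the FSM have states {Run, Reset} with δ(Run, in) = Reset iff V(in), δ(Run, in) = Run otherwise, δ(Reset, in) = Run iff PC = 0, δ(Reset, in) = Reset otherwise. For any input trace satisfying Axiom A4 and with 0 < CR_min, the run of this FSM satisfies both G: { ¬(PC ∈ CR) ∧ (R_en ∨ W_en) ∧ (D_addr ∈ XS) → reset } and G: { (PC ∈ CR) ∧ W_en ∧ ¬(D_addr ∈ XS) ∧ ¬(D_addr ∈ MR) → reset }. -/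

import Mathlib

/-- States of a two-state Run/Reset monitor FSM. -/
inductive S2 where
  | Run : S2
  | Reset : S2
deriving DecidableEq

-- Transition function of a two-state Run/Reset monitor: from `Run` it moves to
-- `Reset` exactly when the violation condition `V` holds of the current inputs, and
-- from `Reset` it moves back to `Run` exactly when `PC = 0`.
open Classical in
noncomputable def twoStateDelta (V : ℕ → Prop) (PC : ℕ → ℕ) : S2 → ℕ → S2
  | S2.Run, t => if V t then S2.Reset else S2.Run
  | S2.Reset, t => if PC t = 0 then S2.Run else S2.Reset

/-- A run of a two-state monitor is in `Reset` whenever the violation condition holds,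
provided that violations never occur while `PC = 0`. -/
theorem eq_reset_of_violation {V : ℕ → Prop} {PC : ℕ → ℕ} {s : ℕ → S2}
    (hs0 : s 0 = S2.Reset)
    (hstep : ∀ t : ℕ, s (t + 1) = twoStateDelta V PC (s t) (t + 1))
    (hV : ∀ t : ℕ, V t → PC t ≠ 0) {t : ℕ} (ht : V t) : s t = S2.Reset := by
  cases t with
  | zero => exact hs0
  | succ t =>
    rw [hstep]
    cases s t with
    | Run => simp [twoStateDelta, ht]
    | Reset => simp [twoStateDelta, hV _ ht]

/-- the exclusive-stack (key confidentiality) FSM of VRASED, with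
violation condition
V := (¬(PC ∈ CR) ∧ (R_en ∨ W_en) ∧ (D_addr ∈ XS)) ∨
     ((PC ∈ CR) ∧ W_en ∧ ¬(D_addr ∈ XS) ∧ ¬(D_addr ∈ MR)),
satisfies, for any input trace satisfying Axiom A4 with 0 < CR_min, both
LTL Specification (5): G { ¬(PC ∈ CR) ∧ (R_en ∨ W_en) ∧ (D_addr ∈ XS) → reset } and
LTL Specification (6): G { (PC ∈ CR) ∧ W_en ∧ ¬(D_addr ∈ XS) ∧ ¬(D_addr ∈ MR) → reset },
where reset(t) := (s(t) = Reset). -/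
theorem exclusive_stack_fsm_satisfies_spec5_spec6
    (CRmin CRmax XSmin XSmax MRmin MRmax : ℕ)
    (hCRmin : 0 < CRmin)
    (PC Daddr DMAaddr : ℕ → ℕ)
    (irq Ren Wen DMAen : ℕ → Prop)
    (s : ℕ → S2)
    (hs0 : s 0 = S2.Reset)
    (hstep : ∀ t : ℕ, s (t + 1) =
      twoStateDelta
        (fun u =>
          (¬(CRmin ≤ PC u ∧ PC u ≤ CRmax) ∧ (Ren u ∨ Wen u) ∧
            (XSmin ≤ Daddr u ∧ Daddr u ≤ XSmax)) ∨
          ((CRmin ≤ PC u ∧ PC u ≤ CRmax) ∧ Wen u ∧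
            ¬(XSmin ≤ Daddr u ∧ Daddr u ≤ XSmax) ∧
            ¬(MRmin ≤ Daddr u ∧ Daddr u ≤ MRmax)))
        PC (s t) (t + 1))
    (hA4 : ∀ t : ℕ, PC t = 0 → ¬Ren t ∧ ¬Wen t ∧ ¬DMAen t ∧ ¬irq t) :
    (∀ t : ℕ,
      (¬(CRmin ≤ PC t ∧ PC t ≤ CRmax) ∧ (Ren t ∨ Wen t) ∧
        (XSmin ≤ Daddr t ∧ Daddr t ≤ XSmax)) →
      s t = S2.Reset) ∧
    (∀ t : ℕ,
      ((CRmin ≤ PC t ∧ PC t ≤ CRmax) ∧ Wen t ∧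
        ¬(XSmin ≤ Daddr t ∧ Daddr t ≤ XSmax) ∧
        ¬(MRmin ≤ Daddr t ∧ Daddr t ≤ MRmax)) →
      s t = S2.Reset) := by
  have hV := fun t => eq_reset_of_violation (t := t) hs0 hstep (by
    rintro u (⟨-, hRW, -⟩ | ⟨-, hW, -⟩) hPC
    · exact hRW.elim (hA4 u hPC).1 (hA4 u hPC).2.1
    · exact (hA4 u hPC).2.1 hW)
  exact ⟨fun t h => hV t (Or.inl h), fun t h => hV t (Or.inr h)⟩
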